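/- arXiv:2206.01782 — 12 statements merged into one kernel-verified Lean document; each statement's English description precedes it below -/
import Mathlib

section
/- The cost operator of the optimal noncausal controller satisfies T_{K₀}*T_{K₀} = G*(1+FF*)⁻¹G, i.e., (FK₀+G)*(FK₀+G) + K₀*K₀ = G*(1+FF*)⁻¹G, where the operator 1+FF* on H_s is invertible (it is bounded below by the identity). -/
open ContinuousLinearMap

/-- The cost operator of the optimal noncausal controller satisfies
`T_{K₀}* T_{K₀} = G* (1 + F F*)⁻¹ G`. -/
theorem clairvoyant_cost_factorization
    {Hw Hu Hs : Type*}
    [NormedAddCommGroup Hw] [InnerProductSpace ℂ Hw] [CompleteSpace Hw]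
    [NormedAddCommGroup Hu] [InnerProductSpace ℂ Hu] [CompleteSpace Hu]
    [NormedAddCommGroup Hs] [InnerProductSpace ℂ Hs] [CompleteSpace Hs]
    (F : Hu →L[ℂ] Hs) (G : Hw →L[ℂ] Hs)
    -- `1 + F*F` is invertible, with (two-sided) inverse `J`
    (J : Hu →L[ℂ] Hu)
    (hJ1 : J ∘L (1 + adjoint F ∘L F) = 1)
    (hJ2 : (1 + adjoint F ∘L F) ∘L J = 1)
    -- `1 + F F*` is invertible, with (two-sided) inverse `J'`
    (J' : Hs →L[ℂ] Hs)
    (hJ'1 : J' ∘L (1 + F ∘L adjoint F) = 1)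
    (hJ'2 : (1 + F ∘L adjoint F) ∘L J' = 1)
    -- the optimal noncausal controller `K₀ = −(1+F*F)⁻¹ F* G`
    (K₀ : Hw →L[ℂ] Hu) (hK₀ : K₀ = -(J ∘L adjoint F ∘L G)) :
    adjoint (F ∘L K₀ + G) ∘L (F ∘L K₀ + G) + adjoint K₀ ∘L K₀ =
      adjoint G ∘L J' ∘L G := by
  set A := J' ∘L G with hA
  have hG : G = A + F ∘L adjoint F ∘L A := by
    ext x
    simpa [hA] using (DFunLike.congr_fun hJ'2 (G x)).symm
  have hK : K₀ = -(adjoint F ∘L A) := by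
    rw [hK₀, neg_inj]
    ext x
    have hx : G x = A x + F (adjoint F (A x)) := DFunLike.congr_fun hG x
    simpa [hx] using DFunLike.congr_fun hJ1 (adjoint F (A x))
  have hFK : F ∘L K₀ + G = A := by
    ext x
    have hx : G x = A x + F (adjoint F (A x)) := DFunLike.congr_fun hG x
    simp [hK, hx]
  have hG_adj : adjoint G = adjoint A + adjoint A ∘L F ∘L adjoint F := by
    conv_lhs => rw [hG]
    simp [adjoint_comp, comp_assoc]
  rw [hFK, hG_adj, hK]
  ext x
  simp [adjoint_comp]
end

section
/- Reduction of the sub-optimal competitive-ratio problem to a norm bound: let γ ∈ ℝ with γ² ≥ 1, and let K : H_w → H_u be a bounded linear operator. Then the following are equivalent: (i) for every w ∈ H_w, ‖(FK+G)w‖² + ‖Kw‖² ≤ γ²‖Mw‖²; (ii) the operator norm of Δ∘(K−K₀)∘M⁻¹ satisfies ‖Δ(K−K₀)M⁻¹‖² ≤ γ² − 1. -/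
open ContinuousLinearMap

/-- If `T*T = 1 + F*F`, then `‖T x‖² = ‖x‖² + ‖F x‖²`. -/
lemma norm_sq_apply_of_adjoint_comp_self_eq
    {Hu Hs : Type*}
    [NormedAddCommGroup Hu] [InnerProductSpace ℂ Hu] [CompleteSpace Hu]
    [NormedAddCommGroup Hs] [InnerProductSpace ℂ Hs] [CompleteSpace Hs]
    {F : Hu →L[ℂ] Hs} {T : Hu →L[ℂ] Hu}
    (hT : adjoint T ∘L T = 1 + adjoint F ∘L F) (x : Hu) :
    ‖T x‖ ^ 2 = ‖x‖ ^ 2 + ‖F x‖ ^ 2 := by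
  rw [apply_norm_sq_eq_inner_adjoint_left, apply_norm_sq_eq_inner_adjoint_left F x, hT,
    add_apply, inner_add_left, map_add, one_apply_eq_self, inner_self_eq_norm_sq]

/-- Completion of squares: with `g = s + F F* s`, the cost at `u = a - F* s` splits
orthogonally. -/
lemma norm_sq_add_norm_sq_adjoint_sub
    {Hu Hs : Type*}
    [NormedAddCommGroup Hu] [InnerProductSpace ℂ Hu] [CompleteSpace Hu]
    [NormedAddCommGroup Hs] [InnerProductSpace ℂ Hs] [CompleteSpace Hs]
    (F : Hu →L[ℂ] Hs) (a : Hu) (s : Hs) :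
    ‖F a + s‖ ^ 2 + ‖a - adjoint F s‖ ^ 2 =
      (‖a‖ ^ 2 + ‖F a‖ ^ 2) + (‖s‖ ^ 2 + ‖adjoint F s‖ ^ 2) := by
  rw [norm_add_sq (𝕜 := ℂ), norm_sub_sq (𝕜 := ℂ), adjoint_inner_right]
  ring

/-- For an invertible `M`, a pointwise bound of `T` by `M` is a bound on `‖T M⁻¹‖`. -/
lemma norm_sq_comp_inverse_le_iff
    {E F : Type*} [NormedAddCommGroup E] [NormedSpace ℂ E]
    [NormedAddCommGroup F] [NormedSpace ℂ F]
    (T : E →L[ℂ] F) {M Minv : E →L[ℂ] E}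
    (hM1 : M ∘L Minv = 1) (hM2 : Minv ∘L M = 1) {c : ℝ} (hc : 0 ≤ c) :
    ‖T ∘L Minv‖ ^ 2 ≤ c ↔ ∀ x, ‖T x‖ ^ 2 ≤ c * ‖M x‖ ^ 2 := by
  constructor
  · intro h x
    have hx : Minv (M x) = x := DFunLike.congr_fun hM2 x
    have hle : ‖T x‖ ≤ ‖T ∘L Minv‖ * ‖M x‖ := by
      simpa [hx] using (T ∘L Minv).le_opNorm (M x)
    calc ‖T x‖ ^ 2 ≤ (‖T ∘L Minv‖ * ‖M x‖) ^ 2 := by gcongr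
      _ = ‖T ∘L Minv‖ ^ 2 * ‖M x‖ ^ 2 := by ring
      _ ≤ c * ‖M x‖ ^ 2 := by gcongr
  · intro h
    rw [← Real.le_sqrt (norm_nonneg _) hc]
    refine opNorm_le_bound _ (Real.sqrt_nonneg c) fun y => ?_
    have hy : M (Minv y) = y := DFunLike.congr_fun hM1 y
    refine (sq_le_sq₀ (norm_nonneg _) (by positivity)).mp ?_
    simpa [mul_pow, Real.sq_sqrt hc, hy] using h (Minv y)

/-- Reduction of the sub-optimal competitive-ratio problem to a norm bound:
for `γ² ≥ 1`, the per-disturbance bound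
`‖(FK+G)w‖² + ‖Kw‖² ≤ γ²‖Mw‖²` holds for all `w` iff
`‖Δ (K − K₀) M⁻¹‖² ≤ γ² − 1`. -/
theorem competitive_ratio_suboptimal_iff_norm_bound
    {Hw Hu Hs : Type*}
    [NormedAddCommGroup Hw] [InnerProductSpace ℂ Hw] [CompleteSpace Hw]
    [NormedAddCommGroup Hu] [InnerProductSpace ℂ Hu] [CompleteSpace Hu]
    [NormedAddCommGroup Hs] [InnerProductSpace ℂ Hs] [CompleteSpace Hs]
    (F : Hu →L[ℂ] Hs) (G : Hw →L[ℂ] Hs)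
    -- `1 + F*F` is invertible, with (two-sided) inverse `J`
    (J : Hu →L[ℂ] Hu)
    (hJ1 : J ∘L (1 + adjoint F ∘L F) = 1)
    (hJ2 : (1 + adjoint F ∘L F) ∘L J = 1)
    -- `1 + F F*` is invertible, with (two-sided) inverse `J'`
    (J' : Hs →L[ℂ] Hs)
    (hJ'1 : J' ∘L (1 + F ∘L adjoint F) = 1)
    (hJ'2 : (1 + F ∘L adjoint F) ∘L J' = 1)
    -- the optimal noncausal controller `K₀ = −(1+F*F)⁻¹ F* G`
    (K₀ : Hw →L[ℂ] Hu) (hK₀ : K₀ = -(J ∘L adjoint F ∘L G))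
    -- `Δ` : an invertible canonical factor of `1 + F*F`
    (Δ Δinv : Hu →L[ℂ] Hu)
    (hΔ1 : Δ ∘L Δinv = 1) (hΔ2 : Δinv ∘L Δ = 1)
    (hΔ : adjoint Δ ∘L Δ = 1 + adjoint F ∘L F)
    -- `M` : an invertible canonical factor of the clairvoyant cost `G*(1+FF*)⁻¹G`
    (M Minv : Hw →L[ℂ] Hw)
    (hM1 : M ∘L Minv = 1) (hM2 : Minv ∘L M = 1)
    (hM : adjoint M ∘L M = adjoint G ∘L J' ∘L G)
    (γ : ℝ) (hγ : 1 ≤ γ ^ 2)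
    (K : Hw →L[ℂ] Hu) :
    (∀ w : Hw, ‖F (K w) + G w‖ ^ 2 + ‖K w‖ ^ 2 ≤ γ ^ 2 * ‖M w‖ ^ 2) ↔
      ‖Δ ∘L (K - K₀) ∘L Minv‖ ^ 2 ≤ γ ^ 2 - 1 := by
  have hsplit (w : Hw) : ‖F (K w) + G w‖ ^ 2 + ‖K w‖ ^ 2 =
      ‖Δ ((K - K₀) w)‖ ^ 2 + ‖M w‖ ^ 2 := by
    set s := J' (G w)
    have hg : s + F (adjoint F s) = G w := DFunLike.congr_fun hJ'2 (G w)
    have hK₀w : K₀ w = -adjoint F s := by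
      have h : J (adjoint F s + adjoint F (F (adjoint F s))) = adjoint F s :=
        DFunLike.congr_fun hJ1 (adjoint F s)
      rw [← map_add, hg] at h
      simp [hK₀, h]
    have hMw : ‖M w‖ ^ 2 = ‖s‖ ^ 2 + ‖adjoint F s‖ ^ 2 := by
      have h : (adjoint M ∘L M) w = adjoint G s := DFunLike.congr_fun hM w
      rw [apply_norm_sq_eq_inner_adjoint_right, h, adjoint_inner_right, ← hg,
        inner_add_left, ← adjoint_inner_right F, map_add, inner_self_eq_norm_sq,
        inner_self_eq_norm_sq]
    have hK : K w = (K - K₀) w - adjoint F s := by simp [hK₀w]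
    have hFK : F (K w) + G w = F ((K - K₀) w) + s := by
      rw [hK, map_sub, ← hg]
      abel
    rw [norm_sq_apply_of_adjoint_comp_self_eq hΔ, hMw, ← norm_sq_add_norm_sq_adjoint_sub,
      ← hK, hFK]
  rw [← comp_assoc, norm_sq_comp_inverse_le_iff _ hM1 hM2 (sub_nonneg.mpr hγ)]
  refine forall_congr' fun w => ?_
  rw [hsplit, sub_mul, one_mul, le_sub_iff_add_le, comp_apply]
end

section
/- Canonical factorization (Lemma 1): for every z ∈ ℂ with |z| = 1 such that zI−A is invertible, I + F(z)ᴴF(z) = Δ(z)ᴴΔ(z), where F(z) = Q^{1/2}(zI−A)⁻¹B_u and Δ(z) = (I+B_uᴴPB_u)^{1/2}(I + K_lqr(zI−A)⁻¹B_u), with (I+B_uᴴPB_u)^{1/2} the Hermitian positive definite square root of I+B_uᴴPB_u. -/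
open Matrix
open scoped ComplexOrder

/-- Canonical factorization (Lemma 1): for `|z| = 1` with `zI − A` invertible,
`I + F(z)ᴴ F(z) = Δ(z)ᴴ Δ(z)` where `F(z) = Q^{1/2}(zI−A)⁻¹B_u` and
`Δ(z) = (I + B_uᴴPB_u)^{1/2}(I + K_lqr(zI−A)⁻¹B_u)`. -/
theorem canonical_factorization {n p : ℕ}
    (A : Matrix (Fin n) (Fin n) ℂ) (Bu : Matrix (Fin n) (Fin p) ℂ)
    (Q Qh : Matrix (Fin n) (Fin n) ℂ)
    (hQ : Q.PosDef) (hQh : Qh.PosDef) (hQh2 : Qh * Qh = Q)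
    (P : Matrix (Fin n) (Fin n) ℂ) (hP : P.PosSemidef)
    (Klqr : Matrix (Fin p) (Fin n) ℂ)
    (hKlqr : Klqr = (1 + Buᴴ * P * Bu)⁻¹ * (Buᴴ * P * A))
    (hRic : P = Aᴴ * P * A + Q - Klqrᴴ * (1 + Buᴴ * P * Bu) * Klqr)
    -- `S` is the Hermitian positive definite square root of `I + B_uᴴ P B_u`
    (S : Matrix (Fin p) (Fin p) ℂ) (hS : S.PosDef) (hS2 : S * S = 1 + Buᴴ * P * Bu)
    (z : ℂ) (hz : ‖z‖ = 1)
    (hzA : IsUnit (z • (1 : Matrix (Fin n) (Fin n) ℂ) - A).det) :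
    1 + (Qh * (z • (1 : Matrix (Fin n) (Fin n) ℂ) - A)⁻¹ * Bu)ᴴ *
          (Qh * (z • (1 : Matrix (Fin n) (Fin n) ℂ) - A)⁻¹ * Bu) =
      (S * (1 + Klqr * (z • (1 : Matrix (Fin n) (Fin n) ℂ) - A)⁻¹ * Bu))ᴴ *
        (S * (1 + Klqr * (z • (1 : Matrix (Fin n) (Fin n) ℂ) - A)⁻¹ * Bu)) := by
  set W := 1 + Buᴴ * P * Bu with hW
  have hWdet : IsUnit W.det := by
    have hSdet := (Matrix.isUnit_iff_isUnit_det S).mp hS.isUnit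
    rw [← hS2, Matrix.det_mul]
    exact hSdet.mul hSdet
  have hWK : W * Klqr = Buᴴ * P * A := by
    rw [hKlqr, Matrix.mul_nonsing_inv_cancel_left _ _ hWdet]
  have hPH : Pᴴ = P := hP.isHermitian
  have hSH : Sᴴ = S := hS.isHermitian
  have hQhH : Qhᴴ = Qh := hQh.isHermitian
  have hQeq : Q = P - Aᴴ * P * A + Klqrᴴ * W * Klqr := by
    rw [eq_sub_iff_add_eq] at hRic
    rw [sub_add_eq_add_sub, hRic, add_sub_cancel_left]
  simp only [Matrix.mul_assoc]
  set X := (z • (1 : Matrix (Fin n) (Fin n) ℂ) - A)⁻¹ * Bu with hX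
  have hzX : z • X = A * X + Bu := by
    have h : (z • (1 : Matrix (Fin n) (Fin n) ℂ) - A) * X = Bu := by
      rw [hX, Matrix.mul_nonsing_inv_cancel_left _ _ hzA]
    rw [← h, Matrix.sub_mul, Matrix.smul_mul, Matrix.one_mul, add_sub_cancel]
  have hzz : star z * z = 1 := by
    rw [Complex.star_def, ← Complex.normSq_eq_conj_mul_self, Complex.normSq_eq_norm_sq, hz]
    simp
  have hXPX : Xᴴ * P * X = (A * X + Bu)ᴴ * P * (A * X + Bu) := by
    rw [← hzX, Matrix.conjTranspose_smul, Matrix.smul_mul, Matrix.smul_mul, Matrix.mul_smul,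
      smul_smul, hzz, one_smul]
  have hWKX : W * (Klqr * X) = Buᴴ * P * (A * X) := by
    rw [← Matrix.mul_assoc, hWK, Matrix.mul_assoc]
  have hWH : Wᴴ = W := by
    rw [← hS2, Matrix.conjTranspose_mul, hSH]
  have hKXW : (Klqr * X)ᴴ * W = (A * X)ᴴ * P * Bu := by
    have h := congrArg Matrix.conjTranspose hWKX
    rw [Matrix.conjTranspose_mul, hWH] at h
    rw [h]
    simp only [Matrix.conjTranspose_mul, Matrix.conjTranspose_conjTranspose, hPH,
      Matrix.mul_assoc]
  calc 1 + (Qh * X)ᴴ * (Qh * X)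
      = 1 + Xᴴ * Q * X := by
        rw [Matrix.conjTranspose_mul, hQhH, ← hQh2]
        simp only [Matrix.mul_assoc]
    _ = 1 + (Xᴴ * P * X - (A * X)ᴴ * P * (A * X) + (Klqr * X)ᴴ * W * (Klqr * X)) := by
        rw [hQeq]
        simp only [Matrix.conjTranspose_mul, Matrix.mul_add, Matrix.add_mul, Matrix.mul_sub,
          Matrix.sub_mul, Matrix.mul_assoc]
    _ = W + W * (Klqr * X) + (Klqr * X)ᴴ * W + (Klqr * X)ᴴ * W * (Klqr * X) := by
        rw [hXPX, hWKX, hKXW, hW, Matrix.conjTranspose_add]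
        simp only [Matrix.mul_add, Matrix.add_mul]
        abel
    _ = (1 + Klqr * X)ᴴ * (S * S) * (1 + Klqr * X) := by
        rw [hS2, Matrix.conjTranspose_add, Matrix.conjTranspose_one]
        simp only [Matrix.mul_add, Matrix.add_mul, Matrix.one_mul, Matrix.mul_one]
        abel
    _ = (S * (1 + Klqr * X))ᴴ * (S * (1 + Klqr * X)) := by
        rw [Matrix.conjTranspose_mul, hSH]
        simp only [Matrix.mul_assoc]
end

section
/- Explicit inverse of the canonical factor Δ: for every z ∈ ℂ such that both zI−A and zI−A_K are invertible, (I + K_lqr(zI−A)⁻¹B_u)(I − K_lqr(zI−A_K)⁻¹B_u) = I and (I − K_lqr(zI−A_K)⁻¹B_u)(I + K_lqr(zI−A)⁻¹B_u) = I; consequently Δ(z) = (I+B_uᴴPB_u)^{1/2}(I + K_lqr(zI−A)⁻¹B_u) is invertible with Δ(z)⁻¹ = (I − K_lqr(zI−A_K)⁻¹B_u)(I+B_uᴴPB_u)^{−1/2}. -/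
open Matrix
open scoped ComplexOrder

/-- Cancellation form of the Woodbury identity: for `M` and `M + B K` invertible,
`1 - K (M + B K)⁻¹ B` is a right inverse of `1 + K M⁻¹ B`. -/
theorem one_add_mul_inv_mul_mul_one_sub {m k R : Type*} [Fintype m] [DecidableEq m]
    [Fintype k] [DecidableEq k] [CommRing R]
    (M N : Matrix m m R) (B : Matrix m k R) (K : Matrix k m R) (hN : N = M + B * K)
    (hMdet : IsUnit M.det) (hNdet : IsUnit N.det) :
    (1 + K * M⁻¹ * B) * (1 - K * N⁻¹ * B) = 1 := by
  have resolvent : M⁻¹ * (B * K) * N⁻¹ = M⁻¹ - N⁻¹ := by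
    rw [show B * K = N - M by rw [hN, add_sub_cancel_left], Matrix.mul_sub, Matrix.sub_mul,
      Matrix.nonsing_inv_mul _ hMdet, Matrix.one_mul, Matrix.mul_assoc,
      Matrix.mul_nonsing_inv _ hNdet, Matrix.mul_one]
  have product : K * M⁻¹ * B * (K * N⁻¹ * B) = K * M⁻¹ * B - K * N⁻¹ * B := by
    rw [← Matrix.sub_mul, ← Matrix.mul_sub, ← resolvent]
    simp only [Matrix.mul_assoc]
  rw [Matrix.add_mul, Matrix.one_mul, Matrix.mul_sub, Matrix.mul_one, product]
  abel

/-- Explicit inverse of the canonical factor `Δ`: for all `z` with `zI − A` and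
`zI − A_K` invertible, `(I + K_lqr(zI−A)⁻¹B_u)` and `(I − K_lqr(zI−A_K)⁻¹B_u)`
are mutually inverse; consequently
`Δ(z)⁻¹ = (I − K_lqr(zI−A_K)⁻¹B_u)(I + B_uᴴPB_u)^{−1/2}`. -/
theorem canonical_factor_inverse {n p : ℕ}
    (A : Matrix (Fin n) (Fin n) ℂ) (Bu : Matrix (Fin n) (Fin p) ℂ)
    (Q : Matrix (Fin n) (Fin n) ℂ) (hQ : Q.PosDef)
    (P : Matrix (Fin n) (Fin n) ℂ) (hP : P.PosSemidef)
    (Klqr : Matrix (Fin p) (Fin n) ℂ)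
    (hKlqr : Klqr = (1 + Buᴴ * P * Bu)⁻¹ * (Buᴴ * P * A))
    (hRic : P = Aᴴ * P * A + Q - Klqrᴴ * (1 + Buᴴ * P * Bu) * Klqr)
    (AK : Matrix (Fin n) (Fin n) ℂ) (hAK : AK = A - Bu * Klqr)
    -- `S` is the Hermitian positive definite square root of `I + B_uᴴ P B_u`
    (S : Matrix (Fin p) (Fin p) ℂ) (hS : S.PosDef) (hS2 : S * S = 1 + Buᴴ * P * Bu)
    (z : ℂ)
    (hzA : IsUnit (z • (1 : Matrix (Fin n) (Fin n) ℂ) - A).det)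
    (hzAK : IsUnit (z • (1 : Matrix (Fin n) (Fin n) ℂ) - AK).det) :
    (1 + Klqr * (z • (1 : Matrix (Fin n) (Fin n) ℂ) - A)⁻¹ * Bu) *
        (1 - Klqr * (z • (1 : Matrix (Fin n) (Fin n) ℂ) - AK)⁻¹ * Bu) = 1 ∧
    (1 - Klqr * (z • (1 : Matrix (Fin n) (Fin n) ℂ) - AK)⁻¹ * Bu) *
        (1 + Klqr * (z • (1 : Matrix (Fin n) (Fin n) ℂ) - A)⁻¹ * Bu) = 1 ∧
    (S * (1 + Klqr * (z • (1 : Matrix (Fin n) (Fin n) ℂ) - A)⁻¹ * Bu))⁻¹ =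
      (1 - Klqr * (z • (1 : Matrix (Fin n) (Fin n) ℂ) - AK)⁻¹ * Bu) * S⁻¹ := by
  have h := one_add_mul_inv_mul_mul_one_sub (z • (1 : Matrix (Fin n) (Fin n) ℂ) - A)
    (z • (1 : Matrix (Fin n) (Fin n) ℂ) - AK) Bu Klqr (by rw [hAK]; abel) hzA hzAK
  refine ⟨h, mul_eq_one_comm.mp h, ?_⟩
  rw [Matrix.mul_inv_rev, Matrix.inv_eq_right_inv h]
end

section
/- Dual canonical factorization (Lemma 2): for every z ∈ ℂ with |z| = 1 such that zI−A is invertible, I + F(z)F(z)ᴴ = ∇(z)∇(z)ᴴ, where F(z) = Q^{1/2}(zI−A)⁻¹B_u and ∇(z) = (Q^{1/2}(zI−A)⁻¹K_T + I)R_T^{1/2}, with R_T^{1/2} the Hermitian positive definite square root of R_T. -/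
open Matrix
open scoped ComplexOrder

/-- The discrete-time Lyapunov identity for the resolvent `W = (zI − A)⁻¹` on the unit circle. -/
theorem resolvent_conj_eq {n : Type*} [Fintype n] [DecidableEq n] {A T W : Matrix n n ℂ} {z : ℂ}
    (hz : ‖z‖ = 1) (hW : W * (z • (1 : Matrix n n ℂ) - A) = 1) :
    W * T * Wᴴ = T + W * A * T + T * Aᴴ * Wᴴ + W * A * T * Aᴴ * Wᴴ := by
  have hzW : z • W = 1 + W * A := by
    rw [mul_sub, mul_smul_comm, mul_one] at hW
    exact sub_eq_iff_eq_add.mp hW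
  have hzz : z * star z = 1 := by
    simp [Complex.mul_conj, Complex.normSq_eq_norm_sq, hz]
  calc W * T * Wᴴ = (z • W) * T * (z • W)ᴴ := by
        rw [conjTranspose_smul, smul_mul_assoc, smul_mul_assoc, mul_smul_comm, smul_smul, hzz,
          one_smul]
    _ = T + W * A * T + T * Aᴴ * Wᴴ + W * A * T * Aᴴ * Wᴴ := by
        rw [hzW, conjTranspose_add, conjTranspose_one, conjTranspose_mul]
        noncomm_ring

/-- Dual canonical factorization (Lemma 2): for `|z| = 1` with `zI − A` invertible,
`I + F(z)F(z)ᴴ = ∇(z)∇(z)ᴴ` where `F(z) = Q^{1/2}(zI−A)⁻¹B_u` and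
`∇(z) = (Q^{1/2}(zI−A)⁻¹K_T + I)R_T^{1/2}`. -/
theorem dual_canonical_factorization {n p : ℕ}
    (A : Matrix (Fin n) (Fin n) ℂ) (Bu : Matrix (Fin n) (Fin p) ℂ)
    (Q Qh : Matrix (Fin n) (Fin n) ℂ)
    (hQ : Q.PosDef) (hQh : Qh.PosDef) (hQh2 : Qh * Qh = Q)
    (T : Matrix (Fin n) (Fin n) ℂ) (hT : T.PosSemidef)
    (RT : Matrix (Fin n) (Fin n) ℂ) (hRT : RT = 1 + Qh * T * Qh)
    (hRicT : T = A * T * Aᴴ + Bu * Buᴴ - A * T * Qh * RT⁻¹ * Qh * T * Aᴴ)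
    (KT : Matrix (Fin n) (Fin n) ℂ) (hKT : KT = A * T * Qh * RT⁻¹)
    (AT : Matrix (Fin n) (Fin n) ℂ) (hAT : AT = A - KT * Qh)
    -- `RTh` is the Hermitian positive definite square root of `R_T`
    (RTh : Matrix (Fin n) (Fin n) ℂ) (hRTh : RTh.PosDef) (hRTh2 : RTh * RTh = RT)
    (z : ℂ) (hz : ‖z‖ = 1)
    (hzA : IsUnit (z • (1 : Matrix (Fin n) (Fin n) ℂ) - A).det) :
    1 + (Qh * (z • (1 : Matrix (Fin n) (Fin n) ℂ) - A)⁻¹ * Bu) *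
          (Qh * (z • (1 : Matrix (Fin n) (Fin n) ℂ) - A)⁻¹ * Bu)ᴴ =
      ((Qh * (z • (1 : Matrix (Fin n) (Fin n) ℂ) - A)⁻¹ * KT + 1) * RTh) *
        ((Qh * (z • (1 : Matrix (Fin n) (Fin n) ℂ) - A)⁻¹ * KT + 1) * RTh)ᴴ := by
  have hRTdet : IsUnit RT.det := by
    rw [← hRTh2, det_mul]
    have h := (isUnit_iff_isUnit_det _).mp hRTh.isUnit
    exact h.mul h
  have hRTH : RTᴴ = RT := by
    rw [← hRTh2, conjTranspose_mul, hRTh.isHermitian.eq]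
  have hKR : KT * RT = A * T * Qh := by
    rw [hKT, Matrix.mul_assoc, nonsing_inv_mul _ hRTdet, Matrix.mul_one]
  have hRK : RT * KTᴴ = Qh * T * Aᴴ := by
    have h := congrArg conjTranspose hKR
    simpa only [conjTranspose_mul, hRTH, hT.isHermitian.eq, hQh.isHermitian.eq,
      Matrix.mul_assoc] using h
  have hKRK : KT * RT * KTᴴ = A * T * Aᴴ + Bu * Buᴴ - T := by
    rw [Matrix.mul_assoc, hRK, hKT, eq_sub_iff_add_eq, ← eq_sub_iff_add_eq']
    simpa only [Matrix.mul_assoc] using hRicT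
  have hW := resolvent_conj_eq (T := T) hz (nonsing_inv_mul _ hzA)
  generalize (z • (1 : Matrix (Fin n) (Fin n) ℂ) - A)⁻¹ = W at hW ⊢
  have hBu : Bu * Buᴴ = KT * RT * KTᴴ + T - A * T * Aᴴ := by
    rw [hKRK]; abel
  calc 1 + (Qh * W * Bu) * (Qh * W * Bu)ᴴ
      = 1 + Qh * W * (Bu * Buᴴ) * Wᴴ * Qh := by
        simp only [conjTranspose_mul, hQh.isHermitian.eq, Matrix.mul_assoc]
    _ = 1 + Qh * (W * T * Wᴴ) * Qh + Qh * W * (KT * RT * KTᴴ) * Wᴴ * Qh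
          - Qh * W * A * T * Aᴴ * Wᴴ * Qh := by
        rw [hBu]; noncomm_ring
    _ = RT + Qh * W * (A * T * Qh) + Qh * T * Aᴴ * Wᴴ * Qh
          + Qh * W * (KT * RT * KTᴴ) * Wᴴ * Qh := by
        rw [hW, hRT]; noncomm_ring
    _ = (Qh * W * KT + 1) * RT * (KTᴴ * Wᴴ * Qh + 1) := by
        rw [← hKR, ← hRK]; noncomm_ring
    _ = ((Qh * W * KT + 1) * RTh) * ((Qh * W * KT + 1) * RTh)ᴴ := by
        rw [← hRTh2]
        simp only [conjTranspose_mul, conjTranspose_add, conjTranspose_one, hQh.isHermitian.eq,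
          hRTh.isHermitian.eq, Matrix.mul_assoc]
end

section
/- Factorization of the clairvoyant controller's cost (Lemma 3): for every z ∈ ℂ with |z| = 1 such that zI−A and zI−A_T are invertible, M(z)ᴴM(z) = G(z)ᴴ(I + F(z)F(z)ᴴ)⁻¹G(z), where F(z) = Q^{1/2}(zI−A)⁻¹B_u, G(z) = Q^{1/2}(zI−A)⁻¹B_w, and M(z) = R_M^{1/2}(K_M(zI−A_T)⁻¹B_w + I), with R_M^{1/2} the Hermitian positive definite square root of R_M. (The matrix I + F(z)F(z)ᴴ is automatically invertible since it is ≥ I.) -/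
open Matrix
open scoped ComplexOrder

/-- Spectral factorization of `1 + F Fᴴ` on the unit circle by a solution of the dual Riccati
equation. -/
theorem one_add_transfer_mul_conjTranspose {ι κ : Type*} [Fintype ι] [DecidableEq ι] [Fintype κ]
    {A K L N R T : Matrix ι ι ℂ} {B : Matrix ι κ ℂ} {z : ℂ}
    (hL : L.IsHermitian) (hT : T.IsHermitian) (hR : R = 1 + L * T * L)
    (hK : K * R = A * T * L) (hRic : T = A * T * Aᴴ + B * Bᴴ - K * R * Kᴴ)
    (hz : z * star z = 1) (hN : N * (z • (1 : Matrix ι ι ℂ) - A) = 1) :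
    1 + (L * N * B) * (L * N * B)ᴴ = (1 + L * N * K) * R * (1 + L * N * K)ᴴ := by
  have hRh : Rᴴ = R := by
    rw [hR]
    simp [hL.eq, hT.eq, Matrix.mul_assoc]
  have hK' : R * Kᴴ = L * T * Aᴴ := by
    simpa [hRh, hL.eq, hT.eq, Matrix.mul_assoc] using congrArg conjTranspose hK
  set X := z • (1 : Matrix ι ι ℂ) - A with hX
  have hB : B * Bᴴ = X * T * Xᴴ + X * T * Aᴴ + A * T * Xᴴ + K * R * Kᴴ := by
    have hXT : X * T * Xᴴ + X * T * Aᴴ + A * T * Xᴴ = T - A * T * Aᴴ := by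
      simp only [hX, conjTranspose_sub, conjTranspose_smul, conjTranspose_one, Matrix.sub_mul,
        Matrix.mul_sub, Matrix.smul_mul, Matrix.mul_smul, Matrix.one_mul, Matrix.mul_one, smul_smul,
        smul_sub, mul_comm (star z) z, hz, one_smul]
      abel
    rw [hXT]
    nth_rewrite 1 [hRic]
    abel
  have hN' : Xᴴ * Nᴴ = 1 := by
    rw [← conjTranspose_mul, hN, conjTranspose_one]
  have cancel : ∀ Y, N * (X * Y) = Y := fun Y => by rw [← Matrix.mul_assoc, hN, Matrix.one_mul]
  have cancel' : ∀ Y, Xᴴ * (Nᴴ * Y) = Y := fun Y => by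
    rw [← Matrix.mul_assoc, hN', Matrix.one_mul]
  calc 1 + (L * N * B) * (L * N * B)ᴴ
      = 1 + L * N * (B * Bᴴ) * (Nᴴ * L) := by
        simp [hL.eq, Matrix.mul_assoc]
    _ = R + L * T * Aᴴ * Nᴴ * L + L * N * (A * T * L) + L * N * (K * R * Kᴴ) * Nᴴ * L := by
        rw [hB, hR]
        simp only [Matrix.mul_add, Matrix.add_mul, Matrix.mul_assoc, cancel, cancel', Matrix.one_mul]
        abel
    _ = (1 + L * N * K) * R * (1 + L * N * K)ᴴ := by
        rw [← hK, ← hK']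
        simp only [conjTranspose_add, conjTranspose_mul, conjTranspose_one, hL.eq, Matrix.mul_add,
          Matrix.add_mul, Matrix.mul_assoc, Matrix.one_mul, Matrix.mul_one]
        abel

/-- A solution of a Riccati equation factors the quadratic form `C` of the resolvent on the unit
circle. -/
theorem riccati_factor_eq_resolvent_form {ι κ : Type*} [Fintype ι] [DecidableEq ι]
    [Fintype κ] [DecidableEq κ] {A C M Y : Matrix ι ι ℂ} {B : Matrix ι κ ℂ}
    {K : Matrix κ ι ℂ} {R : Matrix κ κ ℂ} {z : ℂ}
    (hC : C.IsHermitian) (hM : M.IsHermitian) (hR : R = Bᴴ * (M + C) * B)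
    (hK : R * K = Bᴴ * (M + C) * A) (hRic : M = Aᴴ * (M + C) * A - Kᴴ * (R * K))
    (hz : z * star z = 1) (hY : (z • (1 : Matrix ι ι ℂ) - A) * Y = 1) :
    (K * Y * B + 1)ᴴ * R * (K * Y * B + 1) = (Y * B)ᴴ * C * (Y * B) := by
  have hW : (M + C)ᴴ = M + C := (hM.add hC).eq
  have hRh : Rᴴ = R := by
    rw [hR]
    simp only [conjTranspose_mul, conjTranspose_conjTranspose, hW, Matrix.mul_assoc]
  have hK' : Kᴴ * R = Aᴴ * (M + C) * B := by
    have := congrArg conjTranspose hK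
    simpa only [conjTranspose_mul, conjTranspose_conjTranspose, hRh, hW, Matrix.mul_assoc] using this
  have hKK : Kᴴ * (R * K) = Aᴴ * (M + C) * A - M := by
    exact eq_sub_of_add_eq (add_eq_of_eq_sub' hRic)
  generalize hWdef : M + C = W at *
  have hAY : A * Y + 1 = z • Y := by
    rw [← hY, Matrix.sub_mul, Matrix.smul_mul, Matrix.one_mul]
    abel
  have hYWY : (A * Y + 1)ᴴ * W * (A * Y + 1) = Yᴴ * W * Y := by
    rw [hAY]
    simp only [conjTranspose_smul, Matrix.smul_mul, Matrix.mul_smul, smul_smul, hz, one_smul]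
  calc (K * Y * B + 1)ᴴ * R * (K * Y * B + 1)
      = Bᴴ * Yᴴ * (Kᴴ * (R * K)) * Y * B + Bᴴ * Yᴴ * (Kᴴ * R) + (R * K) * Y * B + R := by
        simp only [conjTranspose_add, conjTranspose_mul, conjTranspose_one, Matrix.mul_add,
          Matrix.add_mul, Matrix.mul_assoc, Matrix.one_mul, Matrix.mul_one]
        abel
    _ = Bᴴ * ((A * Y + 1)ᴴ * W * (A * Y + 1) - Yᴴ * M * Y) * B := by
        rw [hKK, hK', hK, hR]
        simp only [conjTranspose_add, conjTranspose_mul, conjTranspose_one, Matrix.mul_add,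
          Matrix.add_mul, Matrix.mul_sub, Matrix.sub_mul, Matrix.mul_assoc, Matrix.one_mul,
          Matrix.mul_one]
        abel
    _ = (Y * B)ᴴ * C * (Y * B) := by
        rw [hYWY, ← hWdef]
        simp only [conjTranspose_mul, Matrix.mul_add, Matrix.add_mul, Matrix.mul_sub,
          Matrix.sub_mul, Matrix.mul_assoc]
        abel

/-- Factorization of the clairvoyant controller's cost (Lemma 3): for `|z| = 1`
with `zI − A` and `zI − A_T` invertible,
`M(z)ᴴ M(z) = G(z)ᴴ (I + F(z)F(z)ᴴ)⁻¹ G(z)` where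
`M(z) = R_M^{1/2}(K_M(zI−A_T)⁻¹B_w + I)`. -/
theorem clairvoyant_cost_state_space_factorization {n p m : ℕ}
    (A : Matrix (Fin n) (Fin n) ℂ) (Bu : Matrix (Fin n) (Fin p) ℂ)
    (Bw : Matrix (Fin n) (Fin m) ℂ)
    (Q Qh : Matrix (Fin n) (Fin n) ℂ)
    (hQ : Q.PosDef) (hQh : Qh.PosDef) (hQh2 : Qh * Qh = Q)
    (T : Matrix (Fin n) (Fin n) ℂ) (hT : T.PosSemidef)
    (RT : Matrix (Fin n) (Fin n) ℂ) (hRT : RT = 1 + Qh * T * Qh)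
    (hRicT : T = A * T * Aᴴ + Bu * Buᴴ - A * T * Qh * RT⁻¹ * Qh * T * Aᴴ)
    (KT : Matrix (Fin n) (Fin n) ℂ) (hKT : KT = A * T * Qh * RT⁻¹)
    (AT : Matrix (Fin n) (Fin n) ℂ) (hAT : AT = A - KT * Qh)
    (M : Matrix (Fin n) (Fin n) ℂ) (hM : M.IsHermitian)
    (RM : Matrix (Fin m) (Fin m) ℂ)
    (hRM : RM = Bwᴴ * Qh * RT⁻¹ * Qh * Bw + Bwᴴ * M * Bw) (hRMpos : RM.PosDef)
    (KtM : Matrix (Fin m) (Fin n) ℂ)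
    (hKtM : KtM = Bwᴴ * M * AT + Bwᴴ * Qh * RT⁻¹ * Qh * AT)
    (hRicM : M = ATᴴ * M * AT + ATᴴ * Qh * RT⁻¹ * Qh * AT - KtMᴴ * RM⁻¹ * KtM)
    (KM : Matrix (Fin m) (Fin n) ℂ) (hKM : KM = RM⁻¹ * KtM)
    (AM : Matrix (Fin n) (Fin n) ℂ) (hAM : AM = AT - Bw * KM)
    -- `RMh` is the Hermitian positive definite square root of `R_M`
    (RMh : Matrix (Fin m) (Fin m) ℂ) (hRMh : RMh.PosDef) (hRMh2 : RMh * RMh = RM)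
    (z : ℂ) (hz : ‖z‖ = 1)
    (hzA : IsUnit (z • (1 : Matrix (Fin n) (Fin n) ℂ) - A).det)
    (hzAT : IsUnit (z • (1 : Matrix (Fin n) (Fin n) ℂ) - AT).det) :
    (RMh * (KM * (z • (1 : Matrix (Fin n) (Fin n) ℂ) - AT)⁻¹ * Bw + 1))ᴴ *
        (RMh * (KM * (z • (1 : Matrix (Fin n) (Fin n) ℂ) - AT)⁻¹ * Bw + 1)) =
      (Qh * (z • (1 : Matrix (Fin n) (Fin n) ℂ) - A)⁻¹ * Bw)ᴴ *
        (1 + (Qh * (z • (1 : Matrix (Fin n) (Fin n) ℂ) - A)⁻¹ * Bu) *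
              (Qh * (z • (1 : Matrix (Fin n) (Fin n) ℂ) - A)⁻¹ * Bu)ᴴ)⁻¹ *
        (Qh * (z • (1 : Matrix (Fin n) (Fin n) ℂ) - A)⁻¹ * Bw) := by
  have hzz : z * star z = 1 := by
    rw [Complex.star_def, Complex.mul_conj', hz]
    simp
  have hRTpos : RT.PosDef := by
    rw [hRT]
    refine PosDef.one.add_posSemidef ?_
    simpa [hQh.1.eq] using hT.mul_mul_conjTranspose_same Qh
  have hRTdet : IsUnit RT.det := (isUnit_iff_isUnit_det _).1 hRTpos.isUnit
  have hKR : KT * RT = A * T * Qh := by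
    rw [hKT, nonsing_inv_mul_cancel_right _ _ hRTdet]
  have hKTh : KTᴴ = RT⁻¹ * Qh * T * Aᴴ := by
    rw [hKT]
    simp [conjTranspose_nonsing_inv, hRTpos.1.eq, hQh.1.eq, hT.1.eq, Matrix.mul_assoc]
  have hRicT' : T = A * T * Aᴴ + Bu * Buᴴ - KT * RT * KTᴴ := by
    rw [hKR, hKTh]
    simpa only [Matrix.mul_assoc] using hRicT
  have hFF := one_add_transfer_mul_conjTranspose hQh.1 hT.1 hRT hKR hRicT' hzz
    (nonsing_inv_mul _ hzA)
  have hRMdet : IsUnit RM.det := (isUnit_iff_isUnit_det _).1 hRMpos.isUnit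
  have hRK : RM * KM = KtM := by rw [hKM, mul_nonsing_inv_cancel_left _ _ hRMdet]
  have hC : (Qh * RT⁻¹ * Qh).IsHermitian := by
    simp [IsHermitian, conjTranspose_nonsing_inv, hRTpos.1.eq, hQh.1.eq, Matrix.mul_assoc]
  have hKMh : KMᴴ = KtMᴴ * RM⁻¹ := by
    rw [hKM, conjTranspose_mul, conjTranspose_nonsing_inv, hRMpos.1.eq]
  have hMM := riccati_factor_eq_resolvent_form (A := AT) (B := Bw) (K := KM) (R := RM) hC hM
    (by rw [hRM]; simp only [Matrix.mul_add, Matrix.add_mul, Matrix.mul_assoc]; abel)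
    (by rw [hRK, hKtM]; simp only [Matrix.mul_add, Matrix.add_mul, Matrix.mul_assoc])
    (by
      rw [hRK, hKMh]
      simpa only [Matrix.mul_add, Matrix.add_mul, Matrix.mul_assoc] using hRicM)
    hzz (mul_nonsing_inv _ hzAT)
  have hX : z • (1 : Matrix (Fin n) (Fin n) ℂ) - AT =
      (z • (1 : Matrix (Fin n) (Fin n) ℂ) - A) + KT * Qh := by
    rw [hAT]
    abel
  have hY := mul_nonsing_inv _ hzAT
  have hNX := nonsing_inv_mul _ hzA
  set Y := (z • (1 : Matrix (Fin n) (Fin n) ℂ) - AT)⁻¹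
  set N := (z • (1 : Matrix (Fin n) (Fin n) ℂ) - A)⁻¹
  have hPY : (1 + Qh * N * KT) * (Qh * Y) = Qh * N := by
    calc (1 + Qh * N * KT) * (Qh * Y)
        = Qh * (N * (z • (1 : Matrix (Fin n) (Fin n) ℂ) - A)) * Y + Qh * N * KT * Qh * Y := by
          rw [hNX]
          simp only [Matrix.add_mul, Matrix.mul_assoc, Matrix.one_mul]
      _ = Qh * N * ((z • (1 : Matrix (Fin n) (Fin n) ℂ) - AT) * Y) := by
          rw [hX]
          simp only [Matrix.add_mul, Matrix.mul_add, Matrix.mul_assoc]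
      _ = Qh * N := by rw [hY, Matrix.mul_one]
  have hSdet : IsUnit (1 + Qh * N * Bu * (Qh * N * Bu)ᴴ).det :=
    (isUnit_iff_isUnit_det _).1
      (PosDef.one.add_posSemidef (posSemidef_self_mul_conjTranspose _)).isUnit
  have hPdet : IsUnit (1 + Qh * N * KT).det := by
    rw [hFF, Matrix.mul_assoc, det_mul] at hSdet
    exact isUnit_of_mul_isUnit_left hSdet
  rw [hFF]
  generalize 1 + Qh * N * KT = P at hPdet hPY ⊢
  rw [← hPY]
  have hPdet' : IsUnit Pᴴ.det := by
    rw [det_conjTranspose]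
    exact hPdet.star
  calc _ = (KM * Y * Bw + 1)ᴴ * RM * (KM * Y * Bw + 1) := by
        rw [conjTranspose_mul, hRMh.1.eq, ← hRMh2]
        simp only [Matrix.mul_assoc]
    _ = (Y * Bw)ᴴ * (Qh * RT⁻¹ * Qh) * (Y * Bw) := hMM
    _ = _ := by
        simp only [Matrix.mul_inv_rev, conjTranspose_mul, hQh.1.eq, Matrix.mul_assoc]
        rw [nonsing_inv_mul_cancel_left _ _ hPdet, mul_nonsing_inv_cancel_left _ _ hPdet']
end

section
/- Resolvent decomposition via a Sylvester equation (covering the decompositions of the mixed terms ⟨A_Kᴴ⟩Q⟨A⟩ with P = A_KᴴPA + Q, and ⟨A_Kᴴ⟩PB_wK_M⟨A_M⟩ with U = A_KᴴUA_M + PB_wK_M): let A, B, S, X be n×n complex matrices satisfying X = AᴴXB + S, and let z ∈ ℂ, z ≠ 0, be such that z⁻¹I−Aᴴ and zI−B are invertible. Then (z⁻¹I−Aᴴ)⁻¹S(zI−B)⁻¹ = (z⁻¹I−Aᴴ)⁻¹AᴴX + XB(zI−B)⁻¹ + X, a decomposition into an anti-causal part, a strictly causal part, and a constant. -/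
open Matrix

/-- Resolvent decomposition via a Sylvester equation: if `X = Aᴴ X B + S`,
`z ≠ 0`, and `z⁻¹I − Aᴴ`, `zI − B` are invertible, then
`(z⁻¹I−Aᴴ)⁻¹ S (zI−B)⁻¹ = (z⁻¹I−Aᴴ)⁻¹ Aᴴ X + X B (zI−B)⁻¹ + X`. -/
theorem resolvent_sylvester_decomposition {n : ℕ}
    (A B S X : Matrix (Fin n) (Fin n) ℂ)
    (hX : X = Aᴴ * X * B + S)
    (z : ℂ) (hz : z ≠ 0)
    (hzA : IsUnit (z⁻¹ • (1 : Matrix (Fin n) (Fin n) ℂ) - Aᴴ).det)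
    (hzB : IsUnit (z • (1 : Matrix (Fin n) (Fin n) ℂ) - B).det) :
    (z⁻¹ • (1 : Matrix (Fin n) (Fin n) ℂ) - Aᴴ)⁻¹ * S *
        (z • (1 : Matrix (Fin n) (Fin n) ℂ) - B)⁻¹ =
      (z⁻¹ • (1 : Matrix (Fin n) (Fin n) ℂ) - Aᴴ)⁻¹ * Aᴴ * X +
        X * B * (z • (1 : Matrix (Fin n) (Fin n) ℂ) - B)⁻¹ + X := by
  have hS : S = Aᴴ * X * (z • (1 : Matrix (Fin n) (Fin n) ℂ) - B) +
      (z⁻¹ • (1 : Matrix (Fin n) (Fin n) ℂ) - Aᴴ) * (X * B) +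
      (z⁻¹ • (1 : Matrix (Fin n) (Fin n) ℂ) - Aᴴ) * X *
        (z • (1 : Matrix (Fin n) (Fin n) ℂ) - B) := by
    rw [← sub_eq_iff_eq_add'.mpr hX]
    simp only [mul_sub, sub_mul, smul_mul_assoc, mul_smul_comm, one_mul, mul_one, smul_sub,
      smul_smul, mul_inv_cancel₀ hz, one_smul, Matrix.mul_assoc]
    abel
  generalize z⁻¹ • (1 : Matrix (Fin n) (Fin n) ℂ) - Aᴴ = P at *
  generalize z • (1 : Matrix (Fin n) (Fin n) ℂ) - B = Q at *
  rw [hS, mul_add, mul_add, add_mul, add_mul, Matrix.mul_assoc P X Q,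
    nonsing_inv_mul_cancel_left P _ hzA, nonsing_inv_mul_cancel_left P _ hzA,
    mul_nonsing_inv_cancel_right Q _ hzB, ← Matrix.mul_assoc P⁻¹ (Aᴴ * X) Q,
    mul_nonsing_inv_cancel_right Q _ hzB, ← Matrix.mul_assoc P⁻¹ Aᴴ X]
end

section
/- Decomposition of the clairvoyant term (Lemma 4): for every z ∈ ℂ with |z| = 1 such that zI−A, z⁻¹I−A_Kᴴ, zI−A_T, and zI−A_M are invertible, −(Δ(z)ᴴ)⁻¹F(z)ᴴG(z)M(z)⁻¹ = A(z) + C₁(z) + C₂(z), where A(z) = −z⁻¹(I+B_uᴴPB_u)^{−1/2}B_uᴴ(z⁻¹I−A_Kᴴ)⁻¹(P−A_KᴴU)B_wR_M^{−1/2}, C₁(z) = −(I+B_uᴴPB_u)^{−1/2}B_uᴴPA(zI−A)⁻¹B_wM(z)⁻¹, and C₂(z) = (I+B_uᴴPB_u)^{−1/2}B_uᴴU(zI−A_M)⁻¹B_wR_M^{−1/2}, with M(z)⁻¹ = (I − K_M(zI−A_M)⁻¹B_w)R_M^{−1/2}. -/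
open Matrix
open scoped ComplexOrder

namespace Matrix

variable {n p : ℕ}

/-- Resolvent identity behind the state feedback `K`: closing the loop around the transfer matrix
`(zI - A)⁻¹ B` gives the closed-loop transfer matrix. -/
theorem resolvent_mul_inv_one_add_feedback {R Rc : Matrix (Fin n) (Fin n) ℂ}
    {B : Matrix (Fin n) (Fin p) ℂ} {K : Matrix (Fin p) (Fin n) ℂ}
    (hR : IsUnit R.det) (hRc : Rc = R + B * K) (hRcu : IsUnit Rc.det) :
    R⁻¹ * B * (1 + K * R⁻¹ * B)⁻¹ = Rc⁻¹ * B := by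
  have hres : R⁻¹ - Rc⁻¹ = R⁻¹ * B * K * Rc⁻¹ := by
    have h : R⁻¹ * (Rc - R) * Rc⁻¹ = R⁻¹ - Rc⁻¹ := by
      rw [mul_sub, sub_mul, Matrix.mul_assoc, mul_nonsing_inv _ hRcu, nonsing_inv_mul _ hR,
        Matrix.mul_one, Matrix.one_mul]
    rw [← h, hRc, add_sub_cancel_left]
    simp only [Matrix.mul_assoc]
  have hinv : (1 + K * R⁻¹ * B) * (1 - K * Rc⁻¹ * B) = 1 := by
    have h : K * (R⁻¹ - Rc⁻¹) * B = K * (R⁻¹ * B * K * Rc⁻¹) * B := by rw [hres]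
    simp only [Matrix.mul_sub, Matrix.sub_mul, Matrix.add_mul, Matrix.mul_one, Matrix.one_mul,
      Matrix.mul_assoc] at h ⊢
    rw [← h]
    abel
  rw [inv_eq_right_inv hinv]
  have h : (R⁻¹ - Rc⁻¹) * B = R⁻¹ * B * K * Rc⁻¹ * B := by rw [hres]
  simp only [Matrix.mul_sub, Matrix.sub_mul, Matrix.mul_one, Matrix.mul_assoc] at h ⊢
  rw [← h]
  abel

/-- The Riccati equation in closed-loop form. -/
theorem weight_eq_sub_closedLoop {A P Q : Matrix (Fin n) (Fin n) ℂ}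
    {B : Matrix (Fin n) (Fin p) ℂ} {K : Matrix (Fin p) (Fin n) ℂ} {H : Matrix (Fin p) (Fin p) ℂ}
    (hK : H * K = Bᴴ * P * A) (hRic : P = Aᴴ * P * A + Q - Kᴴ * H * K) :
    Q = P - (A - B * K)ᴴ * P * A := by
  have h : Kᴴ * H * K = Kᴴ * Bᴴ * P * A := by
    rw [Matrix.mul_assoc, hK]
    simp only [Matrix.mul_assoc]
  rw [h] at hRic
  rw [conjTranspose_sub, conjTranspose_mul, Matrix.sub_mul, Matrix.sub_mul]
  nth_rewrite 1 [hRic]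
  abel

/-- Partial fractions: a product of an anti-causal and a causal resolvent around a weight
`P - L P A` splits into a sum. -/
theorem resolvent_mul_stein_mul_resolvent {L A P : Matrix (Fin n) (Fin n) ℂ} {z : ℂ} (hz : z ≠ 0)
    (hL : IsUnit (z⁻¹ • (1 : Matrix (Fin n) (Fin n) ℂ) - L).det)
    (hA : IsUnit (z • (1 : Matrix (Fin n) (Fin n) ℂ) - A).det) :
    (z⁻¹ • (1 : Matrix (Fin n) (Fin n) ℂ) - L)⁻¹ * (P - L * P * A) *
        (z • (1 : Matrix (Fin n) (Fin n) ℂ) - A)⁻¹ =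
      z⁻¹ • ((z⁻¹ • (1 : Matrix (Fin n) (Fin n) ℂ) - L)⁻¹ * P) +
        P * A * (z • (1 : Matrix (Fin n) (Fin n) ℂ) - A)⁻¹ := by
  have h : P - L * P * A = z⁻¹ • (P * (z • (1 : Matrix (Fin n) (Fin n) ℂ) - A)) +
      (z⁻¹ • (1 : Matrix (Fin n) (Fin n) ℂ) - L) * (P * A) := by
    simp [Matrix.mul_sub, Matrix.sub_mul, smul_sub, smul_smul, hz, Matrix.mul_assoc]
  rw [h, Matrix.mul_add, Matrix.add_mul, nonsing_inv_mul_cancel_left _ _ hL, Matrix.mul_smul,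
    Matrix.smul_mul,
    ← Matrix.mul_assoc, mul_nonsing_inv_cancel_right _ _ hA]

/-- Partial fractions for a Sylvester equation `U - L U A = V`. -/
theorem smul_resolvent_mul_sylvester_mul_resolvent {L A U V : Matrix (Fin n) (Fin n) ℂ} {z : ℂ}
    (hz : z ≠ 0) (hU : U = L * U * A + V)
    (hL : IsUnit (z⁻¹ • (1 : Matrix (Fin n) (Fin n) ℂ) - L).det)
    (hA : IsUnit (z • (1 : Matrix (Fin n) (Fin n) ℂ) - A).det) :
    z⁻¹ • ((z⁻¹ • (1 : Matrix (Fin n) (Fin n) ℂ) - L)⁻¹ * V *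
        (z • (1 : Matrix (Fin n) (Fin n) ℂ) - A)⁻¹) =
      z⁻¹ • ((z⁻¹ • (1 : Matrix (Fin n) (Fin n) ℂ) - L)⁻¹ * L * U) +
        U * (z • (1 : Matrix (Fin n) (Fin n) ℂ) - A)⁻¹ := by
  have h : z⁻¹ • V = z⁻¹ • (L * U * (z • (1 : Matrix (Fin n) (Fin n) ℂ) - A)) +
      (z⁻¹ • (1 : Matrix (Fin n) (Fin n) ℂ) - L) * U := by
    rw [← sub_eq_of_eq_add' hU]
    simp [Matrix.mul_sub, Matrix.sub_mul, smul_sub, smul_smul, hz, Matrix.mul_assoc]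
  rw [← Matrix.smul_mul, ← Matrix.mul_smul, h, Matrix.mul_add, Matrix.add_mul,
    nonsing_inv_mul_cancel_left _ _ hL, Matrix.mul_smul, Matrix.smul_mul, ← Matrix.mul_assoc,
    mul_nonsing_inv_cancel_right _ _ hA, ← Matrix.mul_assoc]

end Matrix

/-- Decomposition of the clairvoyant term (Lemma 4):
`−(Δ(z)ᴴ)⁻¹ F(z)ᴴ G(z) M(z)⁻¹ = A(z) + C₁(z) + C₂(z)` on the unit circle, where
`A(z)` is anti-causal and `C₁(z), C₂(z)` are strictly causal. -/
theorem clairvoyant_term_decomposition {n p m : ℕ}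
    (A : Matrix (Fin n) (Fin n) ℂ) (Bu : Matrix (Fin n) (Fin p) ℂ)
    (Bw : Matrix (Fin n) (Fin m) ℂ)
    (Q Qh : Matrix (Fin n) (Fin n) ℂ)
    (hQ : Q.PosDef) (hQh : Qh.PosDef) (hQh2 : Qh * Qh = Q)
    -- LQR Riccati equation and closed loop `A_K`
    (P : Matrix (Fin n) (Fin n) ℂ) (hP : P.PosSemidef)
    (Klqr : Matrix (Fin p) (Fin n) ℂ)
    (hKlqr : Klqr = (1 + Buᴴ * P * Bu)⁻¹ * (Buᴴ * P * A))
    (hRic : P = Aᴴ * P * A + Q - Klqrᴴ * (1 + Buᴴ * P * Bu) * Klqr)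
    (AK : Matrix (Fin n) (Fin n) ℂ) (hAK : AK = A - Bu * Klqr)
    -- `S` is the Hermitian positive definite square root of `I + B_uᴴ P B_u`
    (S : Matrix (Fin p) (Fin p) ℂ) (hS : S.PosDef) (hS2 : S * S = 1 + Buᴴ * P * Bu)
    -- dual Riccati equation and closed loop `A_T`
    (T : Matrix (Fin n) (Fin n) ℂ) (hT : T.PosSemidef)
    (RT : Matrix (Fin n) (Fin n) ℂ) (hRT : RT = 1 + Qh * T * Qh)
    (hRicT : T = A * T * Aᴴ + Bu * Buᴴ - A * T * Qh * RT⁻¹ * Qh * T * Aᴴ)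
    (KT : Matrix (Fin n) (Fin n) ℂ) (hKT : KT = A * T * Qh * RT⁻¹)
    (AT : Matrix (Fin n) (Fin n) ℂ) (hAT : AT = A - KT * Qh)
    -- the `M`-Riccati equation, `K_M`, `A_M`
    (M : Matrix (Fin n) (Fin n) ℂ) (hM : M.IsHermitian)
    (RM : Matrix (Fin m) (Fin m) ℂ)
    (hRM : RM = Bwᴴ * Qh * RT⁻¹ * Qh * Bw + Bwᴴ * M * Bw) (hRMpos : RM.PosDef)
    (KtM : Matrix (Fin m) (Fin n) ℂ)
    (hKtM : KtM = Bwᴴ * M * AT + Bwᴴ * Qh * RT⁻¹ * Qh * AT)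
    (hRicM : M = ATᴴ * M * AT + ATᴴ * Qh * RT⁻¹ * Qh * AT - KtMᴴ * RM⁻¹ * KtM)
    (KM : Matrix (Fin m) (Fin n) ℂ) (hKM : KM = RM⁻¹ * KtM)
    (AM : Matrix (Fin n) (Fin n) ℂ) (hAM : AM = AT - Bw * KM)
    -- `RMh` is the Hermitian positive definite square root of `R_M`
    (RMh : Matrix (Fin m) (Fin m) ℂ) (hRMh : RMh.PosDef) (hRMh2 : RMh * RMh = RM)
    -- `U` solves the Sylvester equation
    (U : Matrix (Fin n) (Fin n) ℂ) (hU : U = AKᴴ * U * AM + P * Bw * KM)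
    (z : ℂ) (hz : ‖z‖ = 1)
    (hzA : IsUnit (z • (1 : Matrix (Fin n) (Fin n) ℂ) - A).det)
    (hzAK : IsUnit (z⁻¹ • (1 : Matrix (Fin n) (Fin n) ℂ) - AKᴴ).det)
    (hzAT : IsUnit (z • (1 : Matrix (Fin n) (Fin n) ℂ) - AT).det)
    (hzAM : IsUnit (z • (1 : Matrix (Fin n) (Fin n) ℂ) - AM).det) :
    -(((S * (1 + Klqr * (z • (1 : Matrix (Fin n) (Fin n) ℂ) - A)⁻¹ * Bu))ᴴ)⁻¹ *
          (Qh * (z • (1 : Matrix (Fin n) (Fin n) ℂ) - A)⁻¹ * Bu)ᴴ *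
          (Qh * (z • (1 : Matrix (Fin n) (Fin n) ℂ) - A)⁻¹ * Bw) *
          ((1 - KM * (z • (1 : Matrix (Fin n) (Fin n) ℂ) - AM)⁻¹ * Bw) * RMh⁻¹)) =
      -(z⁻¹ • (S⁻¹ * Buᴴ * (z⁻¹ • (1 : Matrix (Fin n) (Fin n) ℂ) - AKᴴ)⁻¹ *
            (P - AKᴴ * U) * Bw * RMh⁻¹)) +
        -(S⁻¹ * (Buᴴ * P * A) * (z • (1 : Matrix (Fin n) (Fin n) ℂ) - A)⁻¹ * Bw *
            ((1 - KM * (z • (1 : Matrix (Fin n) (Fin n) ℂ) - AM)⁻¹ * Bw) * RMh⁻¹)) +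
        S⁻¹ * Buᴴ * U * (z • (1 : Matrix (Fin n) (Fin n) ℂ) - AM)⁻¹ * Bw * RMh⁻¹ := by
  have hz0 : z ≠ 0 := by
    rintro rfl
    simp at hz
  have hzc : star z = z⁻¹ := (Complex.inv_eq_conj hz).symm
  have hSu : IsUnit S.det := S.isUnit_iff_isUnit_det.mp hS.isUnit
  have hHu : IsUnit (1 + Buᴴ * P * Bu).det := by
    rw [← hS2, det_mul]
    exact hSu.mul hSu
  have hHK : (1 + Buᴴ * P * Bu) * Klqr = Buᴴ * P * A := by
    rw [hKlqr, mul_nonsing_inv_cancel_left _ _ hHu]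
  have hQeq : Q = P - AKᴴ * P * A := hAK ▸ weight_eq_sub_closedLoop hHK hRic
  have hct : (z • (1 : Matrix (Fin n) (Fin n) ℂ) - AK)ᴴ = z⁻¹ • 1 - AKᴴ := by
    rw [conjTranspose_sub, conjTranspose_smul, conjTranspose_one, hzc]
  have hAKu : IsUnit (z • (1 : Matrix (Fin n) (Fin n) ℂ) - AK).det := by
    rw [← hct, det_conjTranspose] at hzAK
    exact isUnit_star.mp hzAK
  have hcl : z • (1 : Matrix (Fin n) (Fin n) ℂ) - AK = z • 1 - A + Bu * Klqr := by
    rw [hAK]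
    abel
  have hFΔ : ((S * (1 + Klqr * (z • (1 : Matrix (Fin n) (Fin n) ℂ) - A)⁻¹ * Bu))ᴴ)⁻¹ *
      (Qh * (z • (1 : Matrix (Fin n) (Fin n) ℂ) - A)⁻¹ * Bu)ᴴ =
        S⁻¹ * Buᴴ * (z⁻¹ • (1 : Matrix (Fin n) (Fin n) ℂ) - AKᴴ)⁻¹ * Qh := by
    rw [← conjTranspose_nonsing_inv, ← conjTranspose_mul, Matrix.mul_inv_rev, ← Matrix.mul_assoc,
      Matrix.mul_assoc Qh, Matrix.mul_assoc Qh,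
      resolvent_mul_inv_one_add_feedback hzA hcl hAKu]
    simp only [conjTranspose_mul, conjTranspose_nonsing_inv, hct, hS.isHermitian.eq,
      hQh.isHermitian.eq, Matrix.mul_assoc]
  have hPF := resolvent_mul_stein_mul_resolvent (P := P) hz0 hzAK hzA
  have hSyl := smul_resolvent_mul_sylvester_mul_resolvent hz0 hU hzAK hzAM
  rw [← hQeq, ← hQh2] at hPF
  rw [hFΔ]
  set X := (z • (1 : Matrix (Fin n) (Fin n) ℂ) - A)⁻¹
  set Y := (z⁻¹ • (1 : Matrix (Fin n) (Fin n) ℂ) - AKᴴ)⁻¹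
  set W := (z • (1 : Matrix (Fin n) (Fin n) ℂ) - AM)⁻¹
  have hLHS : S⁻¹ * Buᴴ * Y * Qh * (Qh * X * Bw) * ((1 - KM * W * Bw) * RMh⁻¹) =
      S⁻¹ * Buᴴ * (Y * (Qh * Qh) * X) * Bw * ((1 - KM * W * Bw) * RMh⁻¹) := by
    simp only [Matrix.mul_assoc]
  have hsplit : S⁻¹ * Buᴴ * (z⁻¹ • (Y * (P * Bw * KM) * W)) * Bw * RMh⁻¹ =
      S⁻¹ * Buᴴ * (z⁻¹ • (Y * AKᴴ * U) + U * W) * Bw * RMh⁻¹ := by rw [hSyl]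
  rw [hLHS, hPF]
  simp only [Matrix.mul_add, Matrix.add_mul, Matrix.mul_sub, Matrix.sub_mul, Matrix.mul_smul,
    Matrix.smul_mul, Matrix.one_mul, Matrix.mul_assoc, smul_sub] at hsplit ⊢
  rw [hsplit]
  abel
end

section
/- Simplified clairvoyant factor for square B_w (Lemma 6): suppose B_w is an invertible n×n matrix. Then for every z ∈ ℂ, z ≠ 0, such that zI−A, zI−A_T, and ∇(z) are invertible: (i) z∇(z)⁻¹G(z) = R_T^{−1/2}Q^{1/2}(I + A_T(zI−A_T)⁻¹)B_w, where G(z) = Q^{1/2}(zI−A)⁻¹B_w; and (ii) setting M(z) := R_T^{−1/2}Q^{1/2}(I + A_T(zI−A_T)⁻¹)B_w, one has M(z)·B_w⁻¹(I − z⁻¹A_T)Q^{−1/2}R_T^{1/2} = I, so M(z)⁻¹ = B_w⁻¹(I − z⁻¹A_T)Q^{−1/2}R_T^{1/2}. -/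
open Matrix
open scoped ComplexOrder

namespace Matrix

variable {m k R : Type*} [Fintype m] [DecidableEq m] [Fintype k] [DecidableEq k] [CommRing R]

theorem one_add_mul_resolvent {X : Matrix m m R} {z : R}
    (h : IsUnit (z • (1 : Matrix m m R) - X).det) :
    1 + X * (z • (1 : Matrix m m R) - X)⁻¹ = z • (z • (1 : Matrix m m R) - X)⁻¹ := by
  have hS := mul_nonsing_inv _ h
  rw [sub_mul, smul_mul, one_mul, sub_eq_iff_eq_add] at hS
  exact hS.symm

/-- Feedback identity relating the open-loop and closed-loop resolvents. -/
theorem mul_inv_mul_add_one_mul_mul_inv {P : Matrix m m R} {C : Matrix k m R}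
    {K : Matrix m k R} (hP : IsUnit P.det) (hPK : IsUnit (P + K * C).det) :
    (C * P⁻¹ * K + 1) * (C * (P + K * C)⁻¹) = C * P⁻¹ := by
  have h : (C * P⁻¹ * K + 1) * C = C * P⁻¹ * (P + K * C) := by
    rw [Matrix.add_mul, Matrix.one_mul, Matrix.mul_add, nonsing_inv_mul_cancel_right _ _ hP,
      Matrix.mul_assoc _ K C, add_comm]
  rw [← Matrix.mul_assoc, h, mul_nonsing_inv_cancel_right _ _ hPK]

end Matrix

/-- Simplified clairvoyant factor for square `B_w` (Lemma 6):
(i) `z ∇(z)⁻¹ G(z) = R_T^{−1/2} Q^{1/2} (I + A_T(zI−A_T)⁻¹) B_w`, and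
(ii) the explicit inverse `M(z)⁻¹ = B_w⁻¹(I − z⁻¹A_T)Q^{−1/2}R_T^{1/2}`. -/
theorem clairvoyant_factor_square_Bw {n p : ℕ}
    (A : Matrix (Fin n) (Fin n) ℂ) (Bu : Matrix (Fin n) (Fin p) ℂ)
    (Bw : Matrix (Fin n) (Fin n) ℂ) (hBw : IsUnit Bw.det)
    (Q Qh : Matrix (Fin n) (Fin n) ℂ)
    (hQ : Q.PosDef) (hQh : Qh.PosDef) (hQh2 : Qh * Qh = Q)
    (T : Matrix (Fin n) (Fin n) ℂ) (hT : T.PosSemidef)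
    (RT : Matrix (Fin n) (Fin n) ℂ) (hRT : RT = 1 + Qh * T * Qh)
    -- `RTh` is the Hermitian positive definite square root of `R_T`
    (RTh : Matrix (Fin n) (Fin n) ℂ) (hRTh : RTh.PosDef) (hRTh2 : RTh * RTh = RT)
    (KT : Matrix (Fin n) (Fin n) ℂ) (hKT : KT = A * T * Qh * RT⁻¹)
    (AT : Matrix (Fin n) (Fin n) ℂ) (hAT : AT = A - KT * Qh)
    (z : ℂ) (hz : z ≠ 0)
    (hzA : IsUnit (z • (1 : Matrix (Fin n) (Fin n) ℂ) - A).det)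
    (hzAT : IsUnit (z • (1 : Matrix (Fin n) (Fin n) ℂ) - AT).det)
    (hnabla : IsUnit ((Qh * (z • (1 : Matrix (Fin n) (Fin n) ℂ) - A)⁻¹ * KT + 1) * RTh).det) :
    z • (((Qh * (z • (1 : Matrix (Fin n) (Fin n) ℂ) - A)⁻¹ * KT + 1) * RTh)⁻¹ *
          (Qh * (z • (1 : Matrix (Fin n) (Fin n) ℂ) - A)⁻¹ * Bw)) =
      RTh⁻¹ * Qh * (1 + AT * (z • (1 : Matrix (Fin n) (Fin n) ℂ) - AT)⁻¹) * Bw ∧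
    (RTh⁻¹ * Qh * (1 + AT * (z • (1 : Matrix (Fin n) (Fin n) ℂ) - AT)⁻¹) * Bw) *
        (Bw⁻¹ * (1 - z⁻¹ • AT) * Qh⁻¹ * RTh) = 1 ∧
    (RTh⁻¹ * Qh * (1 + AT * (z • (1 : Matrix (Fin n) (Fin n) ℂ) - AT)⁻¹) * Bw)⁻¹ =
      Bw⁻¹ * (1 - z⁻¹ • AT) * Qh⁻¹ * RTh := by
  have hQhu : IsUnit Qh.det := hQh.isUnit.map detMonoidHom
  have hRThu : IsUnit RTh.det := hRTh.isUnit.map detMonoidHom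
  have hS : z • (1 : Matrix (Fin n) (Fin n) ℂ) - AT =
      (z • (1 : Matrix (Fin n) (Fin n) ℂ) - A) + KT * Qh := by
    rw [hAT]; abel
  have hfeedback := mul_inv_mul_add_one_mul_mul_inv (C := Qh) (K := KT) hzA (hS ▸ hzAT)
  rw [← hS] at hfeedback
  have hone : 1 - z⁻¹ • AT = z⁻¹ • (z • (1 : Matrix (Fin n) (Fin n) ℂ) - AT) := by
    rw [smul_sub, smul_smul, inv_mul_cancel₀ hz, one_smul]
  rw [one_add_mul_resolvent hzAT, hone]
  set S := z • (1 : Matrix (Fin n) (Fin n) ℂ) - AT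
  have hinv : (RTh⁻¹ * Qh * (z • S⁻¹) * Bw) * (Bw⁻¹ * (z⁻¹ • S) * Qh⁻¹ * RTh) = 1 := by
    simp only [Matrix.mul_assoc, Matrix.mul_smul, Matrix.smul_mul, smul_smul,
      inv_mul_cancel₀ hz, one_smul, mul_nonsing_inv_cancel_left _ _ hBw,
      nonsing_inv_mul_cancel_left _ _ hzAT, mul_nonsing_inv_cancel_left _ _ hQhu,
      nonsing_inv_mul _ hRThu]
  refine ⟨?_, hinv, inv_eq_right_inv hinv⟩
  have hfactor : Qh * (z • (1 : Matrix (Fin n) (Fin n) ℂ) - A)⁻¹ * Bw =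
      (Qh * (z • (1 : Matrix (Fin n) (Fin n) ℂ) - A)⁻¹ * KT + 1) * RTh *
        (RTh⁻¹ * (Qh * (S⁻¹ * Bw))) := by
    rw [Matrix.mul_assoc _ RTh, mul_nonsing_inv_cancel_left _ _ hRThu, ← Matrix.mul_assoc Qh S⁻¹,
      ← Matrix.mul_assoc, hfeedback]
  rw [hfactor, nonsing_inv_mul_cancel_left _ _ hnabla]
  simp only [Matrix.mul_assoc, Matrix.mul_smul, Matrix.smul_mul]
end

section
/- Simplification of the controller constants for square B_w (derivation of Theorem 2 from Theorem 1): suppose B_w is an invertible n×n matrix, Q^{-1}+T is invertible, and set M = 0, R_M = B_wᴴ(Q⁻¹+T)⁻¹B_w, K_M = R_M⁻¹B_wᴴ(Q⁻¹+T)⁻¹A_T, A_M = A_T − B_wK_M. Then: (i) Q^{1/2}(I+Q^{1/2}TQ^{1/2})⁻¹Q^{1/2} = (Q⁻¹+T)⁻¹; (ii) B_wK_M = A_T and hence A_M = 0; (iii) U := PA_T satisfies the Sylvester equation U = A_KᴴUA_M + PB_wK_M; and (iv) (P−A_KᴴU)B_wR_M⁻¹B_wᴴ(P−A_KᴴU)ᴴ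 = (P−A_KᴴPA_T)(Q⁻¹+T)(P−A_TᴴPA_K), where A_Tᴴ P A_K = (A_KᴴPA_T)ᴴ. -/
open Matrix
open scoped ComplexOrder

/-- Simplification of the controller constants for square `B_w`
(derivation of Theorem 2 from Theorem 1): with `M = 0`,
(i) `Q^{1/2}(I + Q^{1/2}TQ^{1/2})⁻¹Q^{1/2} = (Q⁻¹+T)⁻¹`;
(ii) `B_w K_M = A_T` and `A_M = 0`;
(iii) `U = P A_T` solves the Sylvester equation `U = A_Kᴴ U A_M + P B_w K_M`;
(iv) `(P−A_KᴴU) B_w R_M⁻¹ B_wᴴ (P−A_KᴴU)ᴴ = (P−A_KᴴPA_T)(Q⁻¹+T)(P−A_TᴴPA_K)`. -/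
theorem controller_constants_square_Bw {n p : ℕ}
    (A : Matrix (Fin n) (Fin n) ℂ) (Bu : Matrix (Fin n) (Fin p) ℂ)
    (Bw : Matrix (Fin n) (Fin n) ℂ) (hBw : IsUnit Bw.det)
    (Q Qh : Matrix (Fin n) (Fin n) ℂ)
    (hQ : Q.PosDef) (hQh : Qh.PosDef) (hQh2 : Qh * Qh = Q)
    -- LQR Riccati equation and closed loop `A_K`
    (P : Matrix (Fin n) (Fin n) ℂ) (hP : P.PosSemidef)
    (Klqr : Matrix (Fin p) (Fin n) ℂ)
    (hKlqr : Klqr = (1 + Buᴴ * P * Bu)⁻¹ * (Buᴴ * P * A))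
    (hRic : P = Aᴴ * P * A + Q - Klqrᴴ * (1 + Buᴴ * P * Bu) * Klqr)
    (AK : Matrix (Fin n) (Fin n) ℂ) (hAK : AK = A - Bu * Klqr)
    -- dual Riccati equation and closed loop `A_T`
    (T : Matrix (Fin n) (Fin n) ℂ) (hT : T.PosSemidef)
    (RT : Matrix (Fin n) (Fin n) ℂ) (hRT : RT = 1 + Qh * T * Qh)
    (hRicT : T = A * T * Aᴴ + Bu * Buᴴ - A * T * Qh * RT⁻¹ * Qh * T * Aᴴ)
    (AT : Matrix (Fin n) (Fin n) ℂ) (hAT : AT = A - A * T * Qh * RT⁻¹ * Qh)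
    -- `Q⁻¹ + T` is invertible
    (hQT : IsUnit (Q⁻¹ + T).det)
    -- constants for `M = 0`
    (RM : Matrix (Fin n) (Fin n) ℂ) (hRM : RM = Bwᴴ * (Q⁻¹ + T)⁻¹ * Bw)
    (KM : Matrix (Fin n) (Fin n) ℂ) (hKM : KM = RM⁻¹ * (Bwᴴ * (Q⁻¹ + T)⁻¹ * AT))
    (AM : Matrix (Fin n) (Fin n) ℂ) (hAM : AM = AT - Bw * KM) :
    Qh * (1 + Qh * T * Qh)⁻¹ * Qh = (Q⁻¹ + T)⁻¹ ∧
    Bw * KM = AT ∧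
    AM = 0 ∧
    P * AT = AKᴴ * (P * AT) * AM + P * Bw * KM ∧
    (P - AKᴴ * (P * AT)) * Bw * RM⁻¹ * Bwᴴ * (P - AKᴴ * (P * AT))ᴴ =
      (P - AKᴴ * P * AT) * (Q⁻¹ + T) * (P - ATᴴ * P * AK) := by
  have hQhdet : IsUnit Qh.det := (Matrix.isUnit_iff_isUnit_det Qh).mp hQh.isUnit
  have hBwH : IsUnit Bwᴴ.det := by
    rw [det_conjTranspose]
    exact hBw.star
  have hfactor : 1 + Qh * T * Qh = Qh * (Q⁻¹ + T) * Qh := by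
    rw [← hQh2, Matrix.mul_inv_rev, mul_add, add_mul, ← Matrix.mul_assoc,
      mul_nonsing_inv _ hQhdet, Matrix.one_mul, nonsing_inv_mul _ hQhdet]
  generalize Q⁻¹ + T = S at *
  have hRMinv : RM⁻¹ = Bw⁻¹ * S * Bwᴴ⁻¹ := by
    rw [hRM, Matrix.mul_inv_rev, Matrix.mul_inv_rev, nonsing_inv_nonsing_inv _ hQT, Matrix.mul_assoc]
  have hBRB : Bw * RM⁻¹ * Bwᴴ = S := by
    simp only [hRMinv, Matrix.mul_assoc, nonsing_inv_mul _ hBwH, Matrix.mul_one,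
      mul_nonsing_inv_cancel_left _ _ hBw]
  have hBK : Bw * KM = AT := by
    calc Bw * KM = Bw * RM⁻¹ * Bwᴴ * (S⁻¹ * AT) := by simp only [hKM, Matrix.mul_assoc]
      _ = AT := by rw [hBRB, mul_nonsing_inv_cancel_left _ _ hQT]
  have hAM0 : AM = 0 := by rw [hAM, hBK, sub_self]
  refine ⟨?_, hBK, hAM0, ?_, ?_⟩
  · rw [hfactor, Matrix.mul_inv_rev, Matrix.mul_inv_rev, mul_nonsing_inv_cancel_left _ _ hQhdet,
      nonsing_inv_mul_cancel_right _ _ hQhdet]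
  · rw [hAM0, Matrix.mul_zero, zero_add, Matrix.mul_assoc, hBK]
  · have hadj : (P - AKᴴ * (P * AT))ᴴ = P - ATᴴ * P * AK := by
      simp only [conjTranspose_sub, conjTranspose_mul, conjTranspose_conjTranspose,
        hP.isHermitian.eq]
    rw [hadj, Matrix.mul_assoc AKᴴ P AT, ← hBRB]
    simp only [Matrix.mul_assoc]
end

section
/- Scalar primal-dual Riccati duality (used in the proof of Theorem 3): in the scalar setting, T := B_u²P/Q satisfies the scalar dual Riccati equation T = A²T + B_u² − A²QT²/(1+QT), and moreover A/(1+QT) = A/(1+B_u²P) = A_K, so the closed-loop constant A_T := A/(1+QT) of the dual equation coincides with A_K; in particular |A_T| < 1, so T is the stabilizing solution. -/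
/-- Scalar primal-dual Riccati duality: `T = B_u²P/Q` satisfies the scalar dual
Riccati equation, and the closed-loop constant `A_T = A/(1+QT)` coincides with
`A_K = A/(1+B_u²P)`; in particular `|A_T| < 1`. -/
theorem scalar_primal_dual_riccati (A Bu Q P : ℝ)
    (hQ : 0 < Q) (hBu : Bu ≠ 0) (hP : 0 < P)
    (hRic : P = A ^ 2 * P + Q - A ^ 2 * Bu ^ 2 * P ^ 2 / (1 + Bu ^ 2 * P))
    (Klqr : ℝ) (hKlqr : Klqr = Bu * P * A / (1 + Bu ^ 2 * P))
    (AK : ℝ) (hAK : AK = A - Bu * Klqr)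
    (hAKstable : AK ^ 2 < 1)
    (T : ℝ) (hT : T = Bu ^ 2 * P / Q) :
    T = A ^ 2 * T + Bu ^ 2 - A ^ 2 * Q * T ^ 2 / (1 + Q * T) ∧
    A / (1 + Q * T) = A / (1 + Bu ^ 2 * P) ∧
    A / (1 + Bu ^ 2 * P) = AK ∧
    |A / (1 + Q * T)| < 1 := by
  have hD : 1 + Bu ^ 2 * P ≠ 0 := by positivity
  have hQT : Q * T = Bu ^ 2 * P := by
    rw [hT]
    field_simp
  have hcl : A / (1 + Bu ^ 2 * P) = AK := by
    rw [hAK, hKlqr]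
    field_simp
    ring
  refine ⟨?_, by rw [hQT], hcl, ?_⟩
  · apply mul_left_cancel₀ hQ.ne'
    calc Q * T = Bu ^ 2 * P := hQT
      _ = Bu ^ 2 * (A ^ 2 * P + Q - A ^ 2 * Bu ^ 2 * P ^ 2 / (1 + Bu ^ 2 * P)) :=
        congrArg (Bu ^ 2 * ·) hRic
      _ = A ^ 2 * (Bu ^ 2 * P) + Q * Bu ^ 2
          - A ^ 2 * (Bu ^ 2 * P) ^ 2 / (1 + Bu ^ 2 * P) := by ring
      _ = Q * (A ^ 2 * T + Bu ^ 2 - A ^ 2 * Q * T ^ 2 / (1 + Q * T)) := by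
        rw [← hQT]
        ring
  · rw [hQT, hcl]
    exact (sq_lt_one_iff_abs_lt_one AK).mp hAKstable
end

section
/- Optimal competitive ratio for scalar systems (Theorem 3, value): in the scalar setting, with T := B_u²P/Q, A_T := A/(1+QT), Z₁ := B_u²/((1+B_u²P)(1−A_K²)) (the unique solution of the scalar Lyapunov equation Z₁ = A_K²Z₁ + B_u²/(1+B_u²P)), and Π̄ := (P−A_K P A_T)²(Q⁻¹+T)/(1−A_K²) (the unique solution of the scalar Lyapunov equation Π̄ = A_K²Π̄ + (P−A_K P A_T)²(Q⁻¹+T)), the product satisfies Z₁·Π̄ = B_u²P²(Q⁻¹+T)/(1+B_u²P) = B_u²P²/Q; hence the optimal competitive ratio 1 + Z₁Π̄ equals 1 + B_u²P²/Q. -/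
/-- Optimal competitive ratio for scalar systems (Theorem 3, value):
`Z₁` and `Π̄` solve their scalar Lyapunov equations, and
`Z₁·Π̄ = B_u²P²(Q⁻¹+T)/(1+B_u²P) = B_u²P²/Q`; hence the optimal competitive
ratio `1 + Z₁Π̄` equals `1 + B_u²P²/Q`. -/
theorem scalar_optimal_competitive_ratio (A Bu Q P : ℝ)
    (hQ : 0 < Q) (hBu : Bu ≠ 0) (hP : 0 < P)
    (hRic : P = A ^ 2 * P + Q - A ^ 2 * Bu ^ 2 * P ^ 2 / (1 + Bu ^ 2 * P))
    (Klqr : ℝ) (hKlqr : Klqr = Bu * P * A / (1 + Bu ^ 2 * P))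
    (AK : ℝ) (hAK : AK = A - Bu * Klqr)
    (hAKstable : AK ^ 2 < 1)
    (T : ℝ) (hT : T = Bu ^ 2 * P / Q)
    (AT : ℝ) (hAT : AT = A / (1 + Q * T))
    (Z1 : ℝ) (hZ1 : Z1 = Bu ^ 2 / ((1 + Bu ^ 2 * P) * (1 - AK ^ 2)))
    (Pibar : ℝ) (hPibar : Pibar = (P - AK * P * AT) ^ 2 * (Q⁻¹ + T) / (1 - AK ^ 2)) :
    Z1 = AK ^ 2 * Z1 + Bu ^ 2 / (1 + Bu ^ 2 * P) ∧
    Pibar = AK ^ 2 * Pibar + (P - AK * P * AT) ^ 2 * (Q⁻¹ + T) ∧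
    Z1 * Pibar = Bu ^ 2 * P ^ 2 * (Q⁻¹ + T) / (1 + Bu ^ 2 * P) ∧
    Z1 * Pibar = Bu ^ 2 * P ^ 2 / Q ∧
    1 + Z1 * Pibar = 1 + Bu ^ 2 * P ^ 2 / Q := by
  have hD : 1 + Bu ^ 2 * P ≠ 0 := by positivity
  have hQ0 : Q ≠ 0 := hQ.ne'
  have hS : 1 - AK ^ 2 ≠ 0 := by linarith
  have hAT_eq : AT = AK := by
    rw [hAT, hAK, hKlqr, hT, mul_div_cancel₀ _ hQ0]
    field_simp
    ring
  have hQT : Q⁻¹ + T = (1 + Bu ^ 2 * P) / Q := by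
    rw [hT]
    field_simp
  have hdiff : P - AK * P * AT = P * (1 - AK ^ 2) := by
    rw [hAT_eq]
    ring
  have hprod : Z1 * Pibar = Bu ^ 2 * P ^ 2 / Q := by
    rw [hZ1, hPibar, hdiff, hQT]
    field_simp
  refine ⟨?_, ?_, ?_, hprod, by rw [hprod]⟩
  · rw [hZ1]
    field_simp
    ring
  · rw [hPibar]
    field_simp
    ring
  · rw [hprod, hQT]
    field_simp
end
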